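/- Let x₀ > 0 and θ > 0 with M_{x₀} < 2, and let σ < 0. A solution u of u''(x) + (1+iσ)² c(x)^(−2) u(x) = 0 on [x₀, ∞) is bounded on [x₀, ∞) if and only if there is a constant A ∈ ℂ such that u(x) = A · (Σ_{n≥0} s_{σ,n}(x)) · b(x) e^(−i(1+iσ)φ(x)) for all x ≥ x₀, where s_{σ,n}(x) = S_{σ,n}(x) e^(2i(1+iσ)φ(x)) and S_{σ,0}(x) = e^(−2i(1+iσ)φ(x)), S_{σ,n+1} = K_σ(S_{σ,n}). -/

import Mathlib

open MeasureTheory Set Filter Topology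

noncomputable section

/-- The wave speed profile `c(x) = (1 + θ (x₊)^α)^(-1/2)`. -/
def spd (α θ x : ℝ) : ℝ := (1 + θ * (max x 0) ^ α) ^ (-(1 / 2) : ℝ)

/-- The WKB amplitude `b(x) = c(x)^(1/2)`. -/
def amp (α θ x : ℝ) : ℝ := spd α θ x ^ ((1 : ℝ) / 2)

/-- The WKB phase `φ(x) = ∫₀ˣ c(y)⁻¹ dy`. -/
def phase (α θ x : ℝ) : ℝ := ∫ y in (0:ℝ)..x, (spd α θ y)⁻¹

/-- `M(x) = c(x)^(1/2) (c^(1/2))''(x)` for `x > 0`, and `0` for `x ≤ 0`. -/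
def Mfun (α θ x : ℝ) : ℝ :=
  if 0 < x then
    spd α θ x ^ ((1 : ℝ) / 2) * deriv (deriv (fun y => spd α θ y ^ ((1 : ℝ) / 2))) x
  else 0

/-- `M_{x₀} = ∫_{x₀}^∞ |M(x)| dx`. -/
def Mtail (α θ x₀ : ℝ) : ℝ := ∫ x in Ioi x₀, |Mfun α θ x|

/-- The Volterra operator `K_σ`. -/
def Kop (α θ x₀ σ : ℝ) (f : ℝ → ℂ) (x : ℝ) : ℂ :=
  (2 * Complex.I * (1 + Complex.I * (σ : ℂ)))⁻¹ *
    ((∫ y in x₀..x, (Mfun α θ y : ℂ) * f y *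
        Complex.exp (-2 * Complex.I * (1 + Complex.I * (σ : ℂ)) *
          ((phase α θ x - phase α θ y : ℝ) : ℂ))) +
      ∫ y in Ioi x, (Mfun α θ y : ℂ) * f y)

/-- The right-going WKB wave `v^> = b e^{-iφ}`. -/
def vplus (α θ x : ℝ) : ℂ := (amp α θ x : ℂ) * Complex.exp (-Complex.I * (phase α θ x : ℂ))

/-- The left-going WKB wave `v^< = b e^{iφ}`. -/
def vminus (α θ x : ℝ) : ℂ := (amp α θ x : ℂ) * Complex.exp (Complex.I * (phase α θ x : ℂ))

/-- `S` is a bounded continuous solution on `[x₀,∞)` of `S = e^{-2iφ} + K₀ S`. -/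
def IsVolterraSol (α θ x₀ : ℝ) (S : ℝ → ℂ) : Prop :=
  (∃ C, ∀ x ∈ Ici x₀, ‖S x‖ ≤ C) ∧ ContinuousOn S (Ici x₀) ∧
    ∀ x ∈ Ici x₀, S x = Complex.exp (-2 * Complex.I * (phase α θ x : ℂ)) + Kop α θ x₀ 0 S x

/-- `R_{x₀} = (2i)⁻¹ ∫_{x₀}^∞ M S^>`. -/
def Rx (α θ x₀ : ℝ) (S : ℝ → ℂ) : ℂ :=
  (2 * Complex.I)⁻¹ * ∫ x in Ioi x₀, (Mfun α θ x : ℂ) * S x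

/-- Iterates of the Volterra operator: `S_{σ,0} = e^{-2i(1+iσ)φ}`, `S_{σ,n+1} = K_σ S_{σ,n}`. -/
def Sseq (α θ x₀ σ : ℝ) : ℕ → ℝ → ℂ
  | 0 => fun x => Complex.exp (-2 * Complex.I * (1 + Complex.I * (σ : ℂ)) * (phase α θ x : ℂ))
  | n + 1 => Kop α θ x₀ σ (Sseq α θ x₀ σ n)


/-- The integral operator with the kernel `(2κ)⁻¹ M(y) exp(2κ min(φ(x) - φ(y), 0))`. -/
def volt (κ : ℂ) (φ M : ℝ → ℝ) (x₀ : ℝ) (f : ℝ → ℂ) (x : ℝ) : ℂ :=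
  (2 * κ)⁻¹ * ∫ y in Ioi x₀,
    (M y : ℂ) * f y * Complex.exp (2 * κ * ((min (φ x - φ y) 0 : ℝ) : ℂ))

lemma norm_volt_integrand_le {κ : ℂ} {φ M : ℝ → ℝ} {f : ℝ → ℂ} {τ D x y : ℝ} (hτ : 0 ≤ τ)
    (hτκ : τ ≤ 2 * κ.re) (hf : ‖f y‖ ≤ D * Real.exp (τ * φ y)) :
    ‖(M y : ℂ) * f y * Complex.exp (2 * κ * ((min (φ x - φ y) 0 : ℝ) : ℂ))‖ ≤
      |M y| * (D * Real.exp (τ * φ x)) := by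
  have hD : 0 ≤ D := by
    have := (norm_nonneg _).trans hf
    exact nonneg_of_mul_nonneg_left this (Real.exp_pos _)
  rw [norm_mul, norm_mul, Complex.norm_real, Real.norm_eq_abs, Complex.norm_exp, mul_assoc]
  have hre : (2 * κ * ((min (φ x - φ y) 0 : ℝ) : ℂ)).re = 2 * κ.re * min (φ x - φ y) 0 := by
    simp [Complex.mul_re]
  rw [hre]
  refine mul_le_mul_of_nonneg_left ?_ (abs_nonneg _)
  calc ‖f y‖ * Real.exp (2 * κ.re * min (φ x - φ y) 0)
      ≤ D * Real.exp (τ * φ y) * Real.exp (2 * κ.re * min (φ x - φ y) 0) := by gcongr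
    _ = D * Real.exp (τ * φ y + 2 * κ.re * min (φ x - φ y) 0) := by rw [mul_assoc, Real.exp_add]
    _ ≤ D * Real.exp (τ * φ x) := by
      gcongr
      rcases le_total (φ x - φ y) 0 with h | h
      · rw [min_eq_left h]; nlinarith
      · rw [min_eq_right h]; nlinarith

lemma aestronglyMeasurable_volt_integrand {κ : ℂ} {φ M : ℝ → ℝ} {x₀ : ℝ} {f : ℝ → ℂ} (x : ℝ)
    (hM : IntegrableOn M (Ioi x₀)) (hφ : ContinuousOn φ (Ici x₀)) (hf : ContinuousOn f (Ici x₀)) :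
    AEStronglyMeasurable
      (fun y => (M y : ℂ) * f y * Complex.exp (2 * κ * ((min (φ x - φ y) 0 : ℝ) : ℂ)))
      (volume.restrict (Ioi x₀)) := by
  have hf' := hf.mono Ioi_subset_Ici_self
  have hφ' := hφ.mono Ioi_subset_Ici_self
  refine (hM.ofReal.aestronglyMeasurable.mul
    (hf'.aestronglyMeasurable measurableSet_Ioi)).mul
    (ContinuousOn.aestronglyMeasurable ?_ measurableSet_Ioi)
  have : ContinuousOn (fun y => min (φ x - φ y) 0) (Ioi x₀) :=
    (continuousOn_const.sub hφ').inf continuousOn_const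
  exact Complex.continuous_exp.comp_continuousOn
    (continuousOn_const.mul (Complex.continuous_ofReal.comp_continuousOn this))

lemma integrableOn_volt_integrand {κ : ℂ} {φ M : ℝ → ℝ} {x₀ : ℝ} {f : ℝ → ℂ} {τ D : ℝ} (x : ℝ)
    (hM : IntegrableOn M (Ioi x₀)) (hφ : ContinuousOn φ (Ici x₀)) (hf : ContinuousOn f (Ici x₀))
    (hτ : 0 ≤ τ) (hτκ : τ ≤ 2 * κ.re) (hD : ∀ y ∈ Ici x₀, ‖f y‖ ≤ D * Real.exp (τ * φ y)) :
    IntegrableOn (fun y => (M y : ℂ) * f y * Complex.exp (2 * κ * ((min (φ x - φ y) 0 : ℝ) : ℂ)))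
      (Ioi x₀) := by
  refine (hM.abs.mul_const (D * Real.exp (τ * φ x))).mono'
    (aestronglyMeasurable_volt_integrand x hM hφ hf) ?_
  filter_upwards [ae_restrict_mem measurableSet_Ioi] with y hy
  exact norm_volt_integrand_le hτ hτκ (hD y (Ioi_subset_Ici_self hy))

lemma norm_volt_le {κ : ℂ} {φ M : ℝ → ℝ} {x₀ : ℝ} {f : ℝ → ℂ} {τ D : ℝ} (x : ℝ)
    (hM : IntegrableOn M (Ioi x₀))
    (hτ : 0 ≤ τ) (hτκ : τ ≤ 2 * κ.re) (hD : ∀ y ∈ Ici x₀, ‖f y‖ ≤ D * Real.exp (τ * φ y)) :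
    ‖volt κ φ M x₀ f x‖ ≤
      ‖(2 * κ)⁻¹‖ * (∫ y in Ioi x₀, |M y|) * D * Real.exp (τ * φ x) := by
  rw [volt, norm_mul, mul_assoc, mul_assoc, ← integral_mul_const]
  refine mul_le_mul_of_nonneg_left ?_ (norm_nonneg _)
  refine norm_integral_le_of_norm_le (hM.abs.mul_const _) ?_
  filter_upwards [ae_restrict_mem measurableSet_Ioi] with y hy
  exact norm_volt_integrand_le hτ hτκ (hD y (Ioi_subset_Ici_self hy))

lemma continuousOn_volt {κ : ℂ} {φ M : ℝ → ℝ} {x₀ : ℝ} {f : ℝ → ℂ} {D : ℝ} (hκ : 0 ≤ κ.re)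
    (hM : IntegrableOn M (Ioi x₀)) (hφ : ContinuousOn φ (Ici x₀)) (hf : ContinuousOn f (Ici x₀))
    (hD : ∀ y ∈ Ici x₀, ‖f y‖ ≤ D) : ContinuousOn (volt κ φ M x₀ f) (Ici x₀) := by
  refine continuousOn_const.mul fun x hx => ?_
  refine continuousWithinAt_of_dominated (bound := fun y => |M y| * D)
    (Eventually.of_forall fun x => aestronglyMeasurable_volt_integrand x hM hφ hf)
    (Eventually.of_forall fun x => ?_) (hM.abs.mul_const D) (Eventually.of_forall fun y => ?_)
  · filter_upwards [ae_restrict_mem measurableSet_Ioi] with y hy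
    have := norm_volt_integrand_le (κ := κ) (φ := φ) (M := M) (f := f) (τ := 0) (D := D)
      (x := x) (y := y) le_rfl (by linarith) (by simpa using hD y (Ioi_subset_Ici_self hy))
    simpa using this
  · have : ContinuousOn (fun x => min (φ x - φ y) 0) (Ici x₀) :=
      (hφ.sub continuousOn_const).inf continuousOn_const
    exact (continuousOn_const.mul (Complex.continuous_exp.comp_continuousOn
      (continuousOn_const.mul (Complex.continuous_ofReal.comp_continuousOn this)))) x hx

lemma volt_iterate_one {κ : ℂ} {φ M : ℝ → ℝ} {x₀ : ℝ} (hκ : 0 ≤ κ.re)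
    (hM : IntegrableOn M (Ioi x₀)) (hφ : ContinuousOn φ (Ici x₀)) (n : ℕ) :
    ContinuousOn ((volt κ φ M x₀)^[n] 1) (Ici x₀) ∧
      ∀ x ∈ Ici x₀, ‖(volt κ φ M x₀)^[n] 1 x‖ ≤ (‖(2 * κ)⁻¹‖ * ∫ y in Ioi x₀, |M y|) ^ n := by
  induction n with
  | zero => exact ⟨continuousOn_const, fun x _ => by simp⟩
  | succ n ih =>
    rw [Function.iterate_succ_apply']
    refine ⟨continuousOn_volt hκ hM hφ ih.1 ih.2, fun x _ => ?_⟩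
    have := norm_volt_le (τ := 0) (κ := κ) (φ := φ) x hM le_rfl (by linarith)
      (fun y hy => by simpa using ih.2 y hy)
    rw [pow_succ']
    simpa using this

lemma volt_sub_const_mul {κ : ℂ} {φ M : ℝ → ℝ} {x₀ : ℝ} {f g : ℝ → ℂ} {τ D D' : ℝ} (x : ℝ) (A : ℂ)
    (hM : IntegrableOn M (Ioi x₀)) (hφ : ContinuousOn φ (Ici x₀))
    (hf : ContinuousOn f (Ici x₀)) (hg : ContinuousOn g (Ici x₀))
    (hτ : 0 ≤ τ) (hτκ : τ ≤ 2 * κ.re) (hD : ∀ y ∈ Ici x₀, ‖f y‖ ≤ D * Real.exp (τ * φ y))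
    (hD' : ∀ y ∈ Ici x₀, ‖g y‖ ≤ D' * Real.exp (τ * φ y)) :
    volt κ φ M x₀ (fun y => f y - A * g y) x =
      volt κ φ M x₀ f x - A * volt κ φ M x₀ g x := by
  have h1 := integrableOn_volt_integrand (κ := κ) x hM hφ hf hτ hτκ hD
  have h2 := integrableOn_volt_integrand (κ := κ) x hM hφ hg hτ hτκ hD'
  simp only [volt]
  rw [mul_left_comm, ← mul_sub, ← integral_const_mul A, ← integral_sub h1 (h2.const_mul A)]
  congr 2
  ext y
  ring

/-- A fixed point of `w ↦ A + volt w` with subcritical growth is given by the Neumann series. -/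
lemma eq_tsum_of_eq_add_volt {κ : ℂ} {φ M : ℝ → ℝ} {x₀ : ℝ} {w : ℝ → ℂ} {A : ℂ} {τ D : ℝ}
    (hM : IntegrableOn M (Ioi x₀)) (hφ : ContinuousOn φ (Ici x₀))
    (hφ0 : ∀ x ∈ Ici x₀, 0 ≤ φ x) (hw : ContinuousOn w (Ici x₀))
    (hq : ‖(2 * κ)⁻¹‖ * (∫ y in Ioi x₀, |M y|) < 1)
    (hτ : 0 ≤ τ) (hτκ : τ ≤ 2 * κ.re) (hD : ∀ y ∈ Ici x₀, ‖w y‖ ≤ D * Real.exp (τ * φ y))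
    (hfix : ∀ x ∈ Ici x₀, w x = A + volt κ φ M x₀ w x) {x : ℝ} (hx : x ∈ Ici x₀) :
    w x = A * ∑' n : ℕ, (volt κ φ M x₀)^[n] 1 x := by
  set q := ‖(2 * κ)⁻¹‖ * (∫ y in Ioi x₀, |M y|) with hqdef
  have hκ : 0 ≤ κ.re := by linarith
  have hq0 : 0 ≤ q := mul_nonneg (norm_nonneg _) (integral_nonneg fun _ => abs_nonneg _)
  have hs := volt_iterate_one (M := M) hκ hM hφ
  have hexp : ∀ y ∈ Ici x₀, 1 ≤ Real.exp (τ * φ y) := fun y hy =>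
    Real.one_le_exp (mul_nonneg hτ (hφ0 y hy))
  set T : ℕ → ℝ → ℂ := fun N y => ∑ n ∈ Finset.range N, (volt κ φ M x₀)^[n] 1 y with hT
  have hTc : ∀ N, ContinuousOn (T N) (Ici x₀) := fun N =>
    continuousOn_finsetSum _ fun n _ => (hs n).1
  have hTb : ∀ N, ∀ y ∈ Ici x₀, ‖T N y‖ ≤ N * Real.exp (τ * φ y) := fun N y hy => by
    calc ‖T N y‖ ≤ ∑ n ∈ Finset.range N, (1 : ℝ) :=
          norm_sum_le_of_le _ fun n _ => ((hs n).2 y hy).trans (pow_le_one₀ hq0 hq.le)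
      _ = N * 1 := by simp
      _ ≤ _ := by gcongr; exact hexp y hy
  have hTs : ∀ N, ∀ y, T (N + 1) y = 1 + volt κ φ M x₀ (T N) y := by
    intro N y
    induction N with
    | zero => simp [hT, volt]
    | succ N ih =>
      have h1 : T (N + 1) = fun y => T N y - (-1) * (volt κ φ M x₀)^[N] 1 y := by
        ext y; simp only [hT, Finset.sum_range_succ]; ring
      have h2 : T (N + 1 + 1) y = T (N + 1) y + (volt κ φ M x₀)^[N + 1] 1 y := by
        simp only [hT, Finset.sum_range_succ]
      rw [h2, h1, volt_sub_const_mul (D := N) (D' := 1) y _ hM hφ (hTc N) (hs N).1 hτ hτκ (hTb N),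
        ← h1, ih,
        Function.iterate_succ_apply']
      · ring
      · intro y hy
        rw [one_mul]
        exact (((hs N).2 y hy).trans (pow_le_one₀ hq0 hq.le)).trans (hexp y hy)
  have hd : ∀ N, ∀ y ∈ Ici x₀,
      ‖w y - A * T N y‖ ≤ q ^ N * D * Real.exp (τ * φ y) := by
    intro N
    induction N with
    | zero => intro y hy; simpa [hT] using hD y hy
    | succ N ih =>
      intro y hy
      have h1 : w y - A * T (N + 1) y = volt κ φ M x₀ (fun y => w y - A * T N y) y := by
        rw [volt_sub_const_mul y A hM hφ hw (hTc N) hτ hτκ hD (hTb N), hTs]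
        linear_combination hfix y hy
      rw [h1, pow_succ', mul_assoc q]
      exact norm_volt_le y hM hτ hτκ ih
  have hlim : Tendsto (fun N => A * T N x) atTop (𝓝 (w x)) := by
    rw [tendsto_iff_norm_sub_tendsto_zero]
    have h0 := ((tendsto_pow_atTop_nhds_zero_of_lt_one hq0 hq).mul_const D).mul_const
      (Real.exp (τ * φ x))
    rw [zero_mul, zero_mul] at h0
    exact squeeze_zero (fun _ => norm_nonneg _)
      (fun N => (norm_sub_rev _ _).trans_le (hd N x hx)) h0
  have hsum : Summable fun n => (volt κ φ M x₀)^[n] 1 x :=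
    Summable.of_norm_bounded (summable_geometric_of_lt_one hq0 hq) fun n => (hs n).2 x hx
  exact tendsto_nhds_unique hlim (hsum.hasSum.tendsto_sum_nat.const_mul A)

lemma setIntegral_volt_integrand {κ : ℂ} {φ M : ℝ → ℝ} {x₀ x : ℝ} {f : ℝ → ℂ} (hx : x ∈ Ici x₀)
    (hφ : MonotoneOn φ (Ici x₀))
    (hint : IntegrableOn
      (fun y => (M y : ℂ) * f y * Complex.exp (2 * κ * ((min (φ x - φ y) 0 : ℝ) : ℂ))) (Ioi x₀)) :
    ∫ y in Ioi x₀, (M y : ℂ) * f y * Complex.exp (2 * κ * ((min (φ x - φ y) 0 : ℝ) : ℂ)) =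
      (∫ y in x₀..x, (M y : ℂ) * f y) + Complex.exp (2 * κ * φ x) *
        ∫ y in Ioi x, (M y : ℂ) * f y * Complex.exp (-(2 * κ) * φ y) := by
  have hx' : x₀ ≤ x := hx
  rw [← Ioc_union_Ioi_eq_Ioi hx'] at hint ⊢
  rw [setIntegral_union (Ioc_disjoint_Ioi le_rfl) measurableSet_Ioi
    (hint.mono_set subset_union_left) (hint.mono_set subset_union_right),
    intervalIntegral.integral_of_le hx', ← integral_const_mul]
  congr 1
  · refine setIntegral_congr_fun measurableSet_Ioc fun y hy => ?_
    have : 0 ≤ φ x - φ y := sub_nonneg.2 (hφ hy.1.le hx hy.2)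
    simp [min_eq_right this]
  · refine setIntegral_congr_fun measurableSet_Ioi fun y hy => ?_
    have hy' : x < y := hy
    have : φ x - φ y ≤ 0 := sub_nonpos.2 (hφ hx (hx'.trans hy'.le) hy'.le)
    simp only [min_eq_left this]
    rw [mul_left_comm, ← Complex.exp_add]
    congr 2
    push_cast
    ring

/-- The projection of a solution onto one of the two WKB waves. -/
def wkbCoeff (κ : ℂ) (φ b b₁ : ℝ → ℝ) (u u' : ℝ → ℂ) (x : ℝ) : ℂ :=
  Complex.exp (κ * φ x) * (u x * ((b₁ x : ℂ) + κ * (b x : ℂ)⁻¹) - u' x * b x)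

lemma hasDerivAt_wkbCoeff {κ : ℂ} {φ b b₁ : ℝ → ℝ} {u u' : ℝ → ℂ} {x b₂ : ℝ} (hb : 0 < b x)
    (hb₁ : HasDerivAt b (b₁ x) x) (hb₂ : HasDerivAt b₁ b₂ x)
    (hφ : HasDerivAt φ ((b x)⁻¹ ^ 2) x) (hu : HasDerivAt u (u' x) x)
    (hu' : HasDerivAt u' (κ ^ 2 * (b x : ℂ)⁻¹ ^ 4 * u x) x) :
    HasDerivAt (wkbCoeff κ φ b b₁ u u') (Complex.exp (κ * φ x) * (u x * b₂)) x := by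
  have hb0 : (b x : ℂ) ≠ 0 := by exact_mod_cast hb.ne'
  have h := (((hφ.ofReal_comp.const_mul κ).cexp).mul
    ((hu.mul (hb₂.ofReal_comp.add ((hb₁.ofReal_comp.inv hb0).const_mul κ))).sub
      (hu'.mul hb₁.ofReal_comp)))
  refine h.congr_deriv ?_
  simp only [Pi.mul_apply, Pi.add_apply, Pi.sub_apply, Pi.inv_apply]
  push_cast
  field_simp
  ring

lemma eq_wkbCoeff_sub {κ : ℂ} {φ b b₁ : ℝ → ℝ} {u u' : ℝ → ℂ} {x : ℝ} (hb : 0 < b x) :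
    2 * κ * u x = b x * (Complex.exp (-κ * φ x) * wkbCoeff κ φ b b₁ u u' x -
      Complex.exp (κ * φ x) * wkbCoeff (-κ) φ b b₁ u u' x) := by
  have hb0 : (b x : ℂ) ≠ 0 := by exact_mod_cast hb.ne'
  have he : Complex.exp (-κ * φ x) * Complex.exp (κ * φ x) = 1 := by
    rw [← Complex.exp_add]; simp
  simp only [wkbCoeff]
  rw [neg_mul] at he ⊢
  field_simp
  linear_combination (-2 * κ * u x) * he

lemma norm_wkb_quotient_le {κ : ℂ} {φ b : ℝ → ℝ} {u : ℝ → ℂ} {x C K : ℝ} (hb : 0 < b x)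
    (hC : ‖u x‖ ≤ C) (hK : (b x)⁻¹ ≤ K * Real.exp (κ.re / 2 * φ x)) :
    ‖u x * (b x : ℂ)⁻¹ * Complex.exp (κ * φ x)‖ ≤ (C * K) * Real.exp (3 / 2 * κ.re * φ x) := by
  have hC0 : 0 ≤ C := (norm_nonneg _).trans hC
  have hre : (κ * φ x).re = κ.re * φ x := by simp [Complex.mul_re]
  rw [norm_mul, norm_mul, Complex.norm_exp, hre, norm_inv, Complex.norm_real,
    Real.norm_of_nonneg hb.le]
  calc ‖u x‖ * (b x)⁻¹ * Real.exp (κ.re * φ x)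
      ≤ C * (K * Real.exp (κ.re / 2 * φ x)) * Real.exp (κ.re * φ x) := by gcongr
    _ = C * K * (Real.exp (κ.re / 2 * φ x) * Real.exp (κ.re * φ x)) := by ring
    _ = _ := by rw [← Real.exp_add]; ring_nf

lemma continuousOn_wkb_quotient {κ : ℂ} {φ b : ℝ → ℝ} {u : ℝ → ℂ} {t : Set ℝ}
    (hb : ∀ x ∈ t, 0 < b x) (hbc : ContinuousOn b t) (hφ : ContinuousOn φ t)
    (hu : ContinuousOn u t) :
    ContinuousOn (fun x => u x * (b x : ℂ)⁻¹ * Complex.exp (κ * φ x)) t := by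
  have hbc' : ContinuousOn (fun x => (b x : ℂ)) t := Complex.continuous_ofReal.comp_continuousOn hbc
  exact (hu.mul (hbc'.inv₀ fun x hx => by exact_mod_cast (hb x hx).ne')).mul
    (Complex.continuous_exp.comp_continuousOn
      (continuousOn_const.mul (Complex.continuous_ofReal.comp_continuousOn hφ)))

/-- Bounded solutions of `u'' = κ² b⁻⁴ u` satisfy a Volterra equation, up to a constant. -/
lemma exists_eq_add_volt {κ : ℂ} {φ b b₁ b₂ : ℝ → ℝ} {u u' : ℝ → ℂ} {x₀ C : ℝ} (hκ : 0 < κ.re)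
    (hb : ∀ x ∈ Ici x₀, 0 < b x) (hb₁ : ∀ x ∈ Ici x₀, HasDerivAt b (b₁ x) x)
    (hb₂ : ∀ x ∈ Ici x₀, HasDerivAt b₁ (b₂ x) x) (hb₂c : ContinuousOn b₂ (Ici x₀))
    (hanti : AntitoneOn b (Ici x₀)) (hφ : ∀ x ∈ Ici x₀, HasDerivAt φ ((b x)⁻¹ ^ 2) x)
    (hmono : MonotoneOn φ (Ici x₀)) (hφ0 : ∀ x ∈ Ici x₀, 0 ≤ φ x)
    (hφtop : Tendsto φ atTop atTop)
    (hM : IntegrableOn (fun x => b x * b₂ x) (Ioi x₀))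
    (hgrow : ∀ ε : ℝ, 0 < ε → ∃ K, ∀ x ∈ Ici x₀, (b x)⁻¹ ≤ K * Real.exp (ε * φ x))
    (hu : ∀ x ∈ Ici x₀, HasDerivAt u (u' x) x)
    (hu' : ∀ x ∈ Ici x₀, HasDerivAt u' (κ ^ 2 * (b x : ℂ)⁻¹ ^ 4 * u x) x)
    (hC : ∀ x ∈ Ici x₀, ‖u x‖ ≤ C) :
    ∃ A : ℂ, ∀ x ∈ Ici x₀, u x * (b x : ℂ)⁻¹ * Complex.exp (κ * φ x) =
      A + volt κ φ (fun x => b x * b₂ x) x₀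
        (fun x => u x * (b x : ℂ)⁻¹ * Complex.exp (κ * φ x)) x := by
  set s := κ.re with hs
  set P := wkbCoeff κ φ b b₁ u u' with hPdef
  set Q := wkbCoeff (-κ) φ b b₁ u u' with hQdef
  have hκ0 : κ ≠ 0 := by rintro rfl; simp [hs] at hκ
  have hx₀ : x₀ ∈ Ici x₀ := self_mem_Ici
  have hC0 : 0 ≤ C := (norm_nonneg _).trans (hC x₀ hx₀)
  have hφc : ContinuousOn φ (Ici x₀) := fun x hx => (hφ x hx).continuousAt.continuousWithinAt
  have hbc : ContinuousOn b (Ici x₀) := fun x hx => (hb₁ x hx).continuousAt.continuousWithinAt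
  have huc : ContinuousOn u (Ici x₀) := fun x hx => (hu x hx).continuousAt.continuousWithinAt
  have hec : ∀ κ' : ℂ, ContinuousOn (fun x => Complex.exp (κ' * φ x)) (Ici x₀) := fun κ' =>
    Complex.continuous_exp.comp_continuousOn
      (continuousOn_const.mul (Complex.continuous_ofReal.comp_continuousOn hφc))
  have hFc : ∀ κ' : ℂ, ContinuousOn (fun x => Complex.exp (κ' * φ x) * (u x * b₂ x)) (Ici x₀) :=
    fun κ' => (hec κ').mul (huc.mul (Complex.continuous_ofReal.comp_continuousOn hb₂c))
  have hen : ∀ (κ' : ℂ) x, ‖Complex.exp (κ' * φ x)‖ = Real.exp (κ'.re * φ x) := fun κ' x => by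
    rw [Complex.norm_exp]; simp [Complex.mul_re]
  have hP : ∀ x ∈ Ici x₀, HasDerivAt P (Complex.exp (κ * φ x) * (u x * b₂ x)) x := fun x hx =>
    hasDerivAt_wkbCoeff (hb x hx) (hb₁ x hx) (hb₂ x hx) (hφ x hx) (hu x hx) (hu' x hx)
  have hQ : ∀ x ∈ Ici x₀, HasDerivAt Q (Complex.exp (-κ * φ x) * (u x * b₂ x)) x := fun x hx =>
    hasDerivAt_wkbCoeff (hb x hx) (hb₁ x hx) (hb₂ x hx) (hφ x hx) (hu x hx)
      (by rw [neg_sq]; exact hu' x hx)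
  have hPint : ∀ x ∈ Ici x₀,
      ∫ y in x₀..x, Complex.exp (κ * φ y) * (u y * b₂ y) = P x - P x₀ := fun x hx => by
    have hsub : uIcc x₀ x ⊆ Ici x₀ := by
      rw [uIcc_of_le hx]; exact Icc_subset_Ici_self
    exact intervalIntegral.integral_eq_sub_of_hasDerivAt (fun y hy => hP y (hsub hy))
      ((hFc κ).mono hsub).intervalIntegrable
  have hb₂b : ∀ y ∈ Ici x₀, ‖(b₂ y : ℂ)‖ = |b y * b₂ y| * (b y)⁻¹ := fun y hy => by
    have := hb y hy
    rw [Complex.norm_real, Real.norm_eq_abs, abs_mul, abs_of_pos this]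
    field_simp
  have hPb : ∀ x ∈ Ici x₀, ‖b x * (Complex.exp (-κ * φ x) * P x)‖ ≤
      b x₀ * ‖P x₀‖ + ∫ y in Ioi x₀, |b y * b₂ y| * C := fun x hx => by
    have hbx := hb x hx
    have e1 : b x * (Complex.exp (-κ * φ x) * P x) = b x * (Complex.exp (-κ * φ x) * P x₀) +
        ∫ y in x₀..x, b x * Complex.exp (-κ * φ x) * (Complex.exp (κ * φ y) * (u y * b₂ y)) := by
      rw [intervalIntegral.integral_const_mul, hPint x hx]; ring
    rw [e1]
    refine (norm_add_le _ _).trans (add_le_add ?_ ?_)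
    · rw [norm_mul, norm_mul, hen, Complex.norm_real, Real.norm_of_nonneg hbx.le]
      refine mul_le_mul (hanti hx₀ hx hx) (mul_le_of_le_one_left (norm_nonneg _) ?_)
        (by positivity) (hb x₀ hx₀).le
      refine Real.exp_le_one_iff.2 ?_
      rw [Complex.neg_re]
      nlinarith [hφ0 x hx]
    · refine (intervalIntegral.norm_integral_le_of_norm_le (g := fun y => |b y * b₂ y| * C) hx
        (Eventually.of_forall fun y hy => ?_) ?_).trans ?_
      · have hy0 : y ∈ Ici x₀ := hy.1.le
        have hby := hb y hy0
        rw [norm_mul, norm_mul, norm_mul, norm_mul, hen, hen, hb₂b y hy0, Complex.norm_real,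
          Real.norm_of_nonneg hbx.le, Complex.neg_re]
        have h1 : b x * (b y)⁻¹ ≤ 1 := by
          rw [← div_eq_mul_inv, div_le_one hby]; exact hanti hy0 hx hy.2
        have h2 : Real.exp (-s * φ x) * Real.exp (s * φ y) ≤ 1 := by
          rw [← Real.exp_add]
          refine Real.exp_le_one_iff.2 ?_
          nlinarith [hmono hy0 hx hy.2]
        calc b x * Real.exp (-s * φ x) *
              (Real.exp (s * φ y) * (‖u y‖ * (|b y * b₂ y| * (b y)⁻¹)))
            = (b x * (b y)⁻¹) * (Real.exp (-s * φ x) * Real.exp (s * φ y)) *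
              (|b y * b₂ y| * ‖u y‖) := by ring
          _ ≤ 1 * 1 * (|b y * b₂ y| * C) := by
            gcongr
            exact hC y hy0
          _ = _ := by ring
      · rw [intervalIntegrable_iff_integrableOn_Ioc_of_le hx]
        exact IntegrableOn.mono_set (hM.abs.mul_const C) Ioc_subset_Ioi_self
      · rw [intervalIntegral.integral_of_le hx]
        refine setIntegral_mono_set (hM.abs.mul_const C)
          (Eventually.of_forall fun y => ?_) (Ioc_subset_Ioi_self.eventuallyLE)
        simp only [Pi.zero_apply]
        positivity
  obtain ⟨B, hPb⟩ : ∃ B, ∀ x ∈ Ici x₀, ‖b x * (Complex.exp (-κ * φ x) * P x)‖ ≤ B := ⟨_, hPb⟩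
  obtain ⟨K, hK⟩ := hgrow (s / 2) (by positivity)
  have hQb : ∀ x ∈ Ici x₀, ‖Q x‖ ≤ (B + 2 * ‖κ‖ * C) * K * Real.exp (-(s / 2 * φ x)) :=
    fun x hx => by
    have hbx := hb x hx
    have e1 : b x * (Complex.exp (κ * φ x) * Q x) =
        b x * (Complex.exp (-κ * φ x) * P x) - 2 * κ * u x := by
      rw [eq_wkbCoeff_sub (φ := φ) (b₁ := b₁) (u' := u') hbx]; ring
    have e2 : ‖b x * (Complex.exp (κ * φ x) * Q x)‖ ≤ B + 2 * ‖κ‖ * C := by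
      rw [e1]
      refine (norm_sub_le _ _).trans (add_le_add (hPb x hx) ?_)
      rw [norm_mul, norm_mul, Complex.norm_ofNat]
      gcongr
      exact hC x hx
    rw [norm_mul, norm_mul, hen, Complex.norm_real, Real.norm_of_nonneg hbx.le] at e2
    have hexp : Real.exp (s / 2 * φ x) * Real.exp (-(s * φ x)) = Real.exp (-(s / 2 * φ x)) := by
      rw [← Real.exp_add]; ring_nf
    have hpos : Real.exp (s * φ x) * Real.exp (-(s * φ x)) = 1 := by
      rw [← Real.exp_add]; simp
    have hB0 : 0 ≤ B + 2 * ‖κ‖ * C := le_trans (by positivity) e2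
    calc ‖Q x‖ = (b x * (b x)⁻¹) * (Real.exp (s * φ x) * Real.exp (-(s * φ x))) * ‖Q x‖ := by
          rw [hpos, mul_inv_cancel₀ hbx.ne']; ring
      _ = (b x * (Real.exp (s * φ x) * ‖Q x‖)) * (b x)⁻¹ * Real.exp (-(s * φ x)) := by ring
      _ ≤ (B + 2 * ‖κ‖ * C) * (K * Real.exp (s / 2 * φ x)) * Real.exp (-(s * φ x)) := by
          gcongr
          exact hK x hx
      _ = (B + 2 * ‖κ‖ * C) * K * (Real.exp (s / 2 * φ x) * Real.exp (-(s * φ x))) := by ring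
      _ = _ := by rw [hexp]
  have hQlim : Tendsto Q atTop (𝓝 0) := by
    have h1 : Tendsto (fun x => Real.exp (-(s / 2 * φ x))) atTop (𝓝 0) :=
      Real.tendsto_exp_neg_atTop_nhds_zero.comp (hφtop.const_mul_atTop (by positivity))
    have h2 := h1.const_mul ((B + 2 * ‖κ‖ * C) * K)
    rw [mul_zero] at h2
    refine squeeze_zero_norm' ?_ h2
    filter_upwards [Ici_mem_atTop x₀] with x hx using hQb x hx
  have hQI : IntegrableOn (fun x => Complex.exp (-κ * φ x) * (u x * b₂ x)) (Ioi x₀) := by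
    obtain ⟨K', hK'⟩ := hgrow s hκ
    refine (hM.abs.mul_const (C * K')).mono' (((hFc (-κ)).mono
      Ioi_subset_Ici_self).aestronglyMeasurable measurableSet_Ioi) ?_
    filter_upwards [ae_restrict_mem measurableSet_Ioi] with y hy
    have hy0 : y ∈ Ici x₀ := Ioi_subset_Ici_self hy
    have hby := hb y hy0
    have hpos : Real.exp (-s * φ y) * Real.exp (s * φ y) = 1 := by
      rw [← Real.exp_add]; simp
    rw [norm_mul, norm_mul, hen, hb₂b y hy0, Complex.neg_re]
    calc Real.exp (-s * φ y) * (‖u y‖ * (|b y * b₂ y| * (b y)⁻¹))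
        ≤ Real.exp (-s * φ y) * (C * (|b y * b₂ y| * (K' * Real.exp (s * φ y)))) := by
          gcongr
          · exact hC y hy0
          · exact hK' y hy0
      _ = (Real.exp (-s * φ y) * Real.exp (s * φ y)) * (|b y * b₂ y| * (C * K')) := by ring
      _ = _ := by rw [hpos, one_mul]
  have hQint : ∀ x ∈ Ici x₀,
      ∫ y in Ioi x, Complex.exp (-κ * φ y) * (u y * b₂ y) = -Q x := fun x hx => by
    rw [integral_Ioi_of_hasDerivAt_of_tendsto' (fun y hy => hQ y (Ici_subset_Ici.2 hx hy))
      (hQI.mono_set (Ioi_subset_Ioi hx)) hQlim, zero_sub]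
  have hwc : ContinuousOn (fun x => u x * (b x : ℂ)⁻¹ * Complex.exp (κ * φ x)) (Ici x₀) :=
    continuousOn_wkb_quotient hb hbc hφc huc
  have hwb : ∀ x ∈ Ici x₀, ‖u x * (b x : ℂ)⁻¹ * Complex.exp (κ * φ x)‖ ≤
      (C * K) * Real.exp (3 / 2 * s * φ x) := fun x hx =>
    norm_wkb_quotient_le (hb x hx) (hC x hx) (hK x hx)
  refine ⟨(2 * κ)⁻¹ * P x₀, fun x hx => ?_⟩
  rw [volt, setIntegral_volt_integrand hx hmono (integrableOn_volt_integrand x hM hφc hwc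
    (by positivity) (by linarith) hwb)]
  have hb0 : (b x : ℂ) ≠ 0 := by exact_mod_cast (hb x hx).ne'
  have i1 : ∫ y in x₀..x, ((b y * b₂ y : ℝ) : ℂ) * (u y * (b y : ℂ)⁻¹ * Complex.exp (κ * φ y)) =
      P x - P x₀ := by
    rw [← hPint x hx]
    refine intervalIntegral.integral_congr fun y hy => ?_
    rw [uIcc_of_le hx] at hy
    have hby : (b y : ℂ) ≠ 0 := by exact_mod_cast (hb y hy.1).ne'
    push_cast
    field_simp
  have i2 : ∫ y in Ioi x, ((b y * b₂ y : ℝ) : ℂ) * (u y * (b y : ℂ)⁻¹ * Complex.exp (κ * φ y)) *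
      Complex.exp (-(2 * κ) * φ y) = -Q x := by
    rw [← hQint x hx]
    refine setIntegral_congr_fun measurableSet_Ioi fun y hy => ?_
    have hby : (b y : ℂ) ≠ 0 := by
      exact_mod_cast (hb y (Ici_subset_Ici.2 hx (Ioi_subset_Ici_self hy))).ne'
    have he : Complex.exp (-κ * φ y) = Complex.exp (κ * φ y) * Complex.exp (-(2 * κ) * φ y) := by
      rw [← Complex.exp_add]; ring_nf
    simp only [he]
    push_cast
    field_simp
  rw [i1, i2]
  have key := eq_wkbCoeff_sub (κ := κ) (φ := φ) (b₁ := b₁) (u := u) (u' := u') (hb x hx)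
  rw [← hPdef, ← hQdef] at key
  have he1 : Complex.exp (-κ * φ x) * Complex.exp (κ * φ x) = 1 := by
    rw [← Complex.exp_add]; simp
  have he2 : Complex.exp (2 * κ * φ x) = Complex.exp (κ * φ x) * Complex.exp (κ * φ x) := by
    rw [← Complex.exp_add]; ring_nf
  rw [he2]
  field_simp
  linear_combination Complex.exp (κ * φ x) * key + b x * P x * he1

/-- Bounded solutions of `u'' = κ² b⁻⁴ u` are the multiples of the Neumann series of `volt`. -/
lemma bounded_iff_exists_eq_tsum {κ : ℂ} {φ b b₁ b₂ : ℝ → ℝ} {u u' : ℝ → ℂ} {x₀ : ℝ}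
    (hκ : 0 < κ.re)
    (hb : ∀ x ∈ Ici x₀, 0 < b x) (hb₁ : ∀ x ∈ Ici x₀, HasDerivAt b (b₁ x) x)
    (hb₂ : ∀ x ∈ Ici x₀, HasDerivAt b₁ (b₂ x) x) (hb₂c : ContinuousOn b₂ (Ici x₀))
    (hanti : AntitoneOn b (Ici x₀)) (hφ : ∀ x ∈ Ici x₀, HasDerivAt φ ((b x)⁻¹ ^ 2) x)
    (hmono : MonotoneOn φ (Ici x₀)) (hφ0 : ∀ x ∈ Ici x₀, 0 ≤ φ x)
    (hφtop : Tendsto φ atTop atTop)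
    (hM : IntegrableOn (fun x => b x * b₂ x) (Ioi x₀))
    (hq : ‖(2 * κ)⁻¹‖ * (∫ y in Ioi x₀, |b y * b₂ y|) < 1)
    (hgrow : ∀ ε : ℝ, 0 < ε → ∃ K, ∀ x ∈ Ici x₀, (b x)⁻¹ ≤ K * Real.exp (ε * φ x))
    (hu : ∀ x ∈ Ici x₀, HasDerivAt u (u' x) x)
    (hu' : ∀ x ∈ Ici x₀, HasDerivAt u' (κ ^ 2 * (b x : ℂ)⁻¹ ^ 4 * u x) x) :
    (∃ C, ∀ x ∈ Ici x₀, ‖u x‖ ≤ C) ↔ ∃ A : ℂ, ∀ x ∈ Ici x₀,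
      u x = A * (∑' n : ℕ, (volt κ φ (fun x => b x * b₂ x) x₀)^[n] 1 x) * b x *
        Complex.exp (-κ * φ x) := by
  have hφc : ContinuousOn φ (Ici x₀) := fun x hx => (hφ x hx).continuousAt.continuousWithinAt
  have hen : ∀ (κ' : ℂ) x, ‖Complex.exp (κ' * φ x)‖ = Real.exp (κ'.re * φ x) := fun κ' x => by
    rw [Complex.norm_exp]; simp [Complex.mul_re]
  constructor
  · rintro ⟨C, hC⟩
    obtain ⟨A, hA⟩ := exists_eq_add_volt hκ hb hb₁ hb₂ hb₂c hanti hφ hmono hφ0 hφtop hM hgrow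
      hu hu' hC
    have hbc : ContinuousOn b (Ici x₀) := fun x hx => (hb₁ x hx).continuousAt.continuousWithinAt
    have huc : ContinuousOn u (Ici x₀) := fun x hx => (hu x hx).continuousAt.continuousWithinAt
    obtain ⟨K, hK⟩ := hgrow (κ.re / 2) (by positivity)
    refine ⟨A, fun x hx => ?_⟩
    rw [← eq_tsum_of_eq_add_volt (τ := 3 / 2 * κ.re) hM hφc hφ0
      (continuousOn_wkb_quotient hb hbc hφc huc) hq (by positivity) (by linarith)
      (fun y hy => norm_wkb_quotient_le (hb y hy) (hC y hy) (hK y hy)) hA hx]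
    have he1 : Complex.exp (-κ * φ x) * Complex.exp (κ * φ x) = 1 := by
      rw [← Complex.exp_add]; simp
    have hb0 : (b x : ℂ) ≠ 0 := by exact_mod_cast (hb x hx).ne'
    rw [neg_mul] at he1 ⊢
    field_simp
    linear_combination -u x * he1
  · rintro ⟨A, hA⟩
    refine ⟨‖A‖ * (1 - ‖(2 * κ)⁻¹‖ * (∫ y in Ioi x₀, |b y * b₂ y|))⁻¹ * b x₀ * 1, fun x hx => ?_⟩
    have hbx := hb x hx
    rw [hA x hx, norm_mul, norm_mul, norm_mul, Complex.norm_real, Real.norm_of_nonneg hbx.le, hen]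
    have hq0 : 0 ≤ ‖(2 * κ)⁻¹‖ * (∫ y in Ioi x₀, |b y * b₂ y|) :=
      mul_nonneg (norm_nonneg _) (integral_nonneg fun _ => abs_nonneg _)
    have hs : ‖∑' n : ℕ, (volt κ φ (fun x => b x * b₂ x) x₀)^[n] 1 x‖ ≤
        (1 - ‖(2 * κ)⁻¹‖ * (∫ y in Ioi x₀, |b y * b₂ y|))⁻¹ :=
      tsum_of_norm_bounded (hasSum_geometric_of_lt_one hq0 hq) fun n =>
        (volt_iterate_one hκ.le hM hφc n).2 x hx
    have hexp : Real.exp ((-κ).re * φ x) ≤ 1 := by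
      refine Real.exp_le_one_iff.2 ?_
      rw [Complex.neg_re]
      nlinarith [hφ0 x hx]
    have hb0 := (hb x₀ self_mem_Ici).le
    have hs0 := (norm_nonneg _).trans hs
    have hbb := hanti self_mem_Ici hx hx
    gcongr

/-- The derivative of `amp`. -/
def ampDeriv (α θ x : ℝ) : ℝ :=
  θ * (α * x ^ (α - 1)) * (-(1 / 4)) * (1 + θ * x ^ α) ^ (-(5 / 4) : ℝ)

/-- The second derivative of `amp`. -/
def ampDeriv₂ (α θ x : ℝ) : ℝ :=
  θ * (α * ((α - 1) * x ^ (α - 2))) * (-(1 / 4)) * (1 + θ * x ^ α) ^ (-(5 / 4) : ℝ) +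
    (θ * (α * x ^ (α - 1))) ^ 2 * (5 / 16) * (1 + θ * x ^ α) ^ (-(9 / 4) : ℝ)

lemma one_le_one_add_mul_rpow {α θ x : ℝ} (hθ : 0 < θ) (hx : 0 ≤ x) : 1 ≤ 1 + θ * x ^ α := by
  have := Real.rpow_nonneg hx α
  nlinarith [mul_nonneg hθ.le this]

lemma spd_pos {α θ : ℝ} (hθ : 0 < θ) (x : ℝ) : 0 < spd α θ x :=
  Real.rpow_pos_of_pos (by linarith [one_le_one_add_mul_rpow (α := α) hθ (le_max_right x 0)]) _

lemma spd_le_one {α θ : ℝ} (hθ : 0 < θ) (x : ℝ) : spd α θ x ≤ 1 :=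
  Real.rpow_le_one_of_one_le_of_nonpos (one_le_one_add_mul_rpow hθ (le_max_right x 0)) (by norm_num)

lemma spd_antitone {α θ : ℝ} (hα : 0 < α) (hθ : 0 < θ) : Antitone (spd α θ) := by
  intro x y hxy
  refine Real.rpow_le_rpow_of_nonpos
    (by linarith [one_le_one_add_mul_rpow (α := α) hθ (le_max_right x 0)]) ?_ (by norm_num)
  gcongr

lemma spd_continuous {α θ : ℝ} (hα : 0 < α) (hθ : 0 < θ) : Continuous (spd α θ) := by
  refine Continuous.rpow_const ?_ fun x => Or.inl
    (by linarith [one_le_one_add_mul_rpow (α := α) hθ (le_max_right x 0)] :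
      (0 : ℝ) < 1 + θ * (max x 0) ^ α).ne'
  exact continuous_const.add (continuous_const.mul
    ((continuous_id.max continuous_const).rpow_const fun _ => Or.inr hα.le))

lemma amp_pos {α θ : ℝ} (hθ : 0 < θ) (x : ℝ) : 0 < amp α θ x :=
  Real.rpow_pos_of_pos (spd_pos hθ x) _

lemma amp_antitone {α θ : ℝ} (hα : 0 < α) (hθ : 0 < θ) : Antitone (amp α θ) := fun _ y hxy =>
  Real.rpow_le_rpow (spd_pos hθ y).le (spd_antitone hα hθ hxy) (by norm_num)

lemma amp_sq {α θ : ℝ} (hθ : 0 < θ) (x : ℝ) : amp α θ x ^ 2 = spd α θ x := by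
  rw [amp, ← Real.rpow_natCast, ← Real.rpow_mul (spd_pos hθ x).le]
  norm_num

lemma amp_eq {α θ x : ℝ} (hθ : 0 < θ) (hx : 0 < x) :
    amp α θ x = (1 + θ * x ^ α) ^ (-(1 / 4) : ℝ) := by
  rw [amp, spd, max_eq_left hx.le,
    ← Real.rpow_mul (by linarith [one_le_one_add_mul_rpow (α := α) hθ hx.le])]
  norm_num

lemma hasDerivAt_one_add_mul_rpow {α θ x : ℝ} (hx : 0 < x) :
    HasDerivAt (fun x => 1 + θ * x ^ α) (θ * (α * x ^ (α - 1))) x :=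
  ((Real.hasDerivAt_rpow_const (Or.inl hx.ne')).const_mul θ).const_add 1

lemma hasDerivAt_amp {α θ x : ℝ} (hθ : 0 < θ) (hx : 0 < x) :
    HasDerivAt (amp α θ) (ampDeriv α θ x) x := by
  have hg := one_le_one_add_mul_rpow (α := α) hθ hx.le
  have h := (hasDerivAt_one_add_mul_rpow (α := α) (θ := θ) hx).rpow_const
    (p := -(1 / 4)) (Or.inl (by linarith))
  refine (h.congr_of_eventuallyEq ?_).congr_deriv ?_
  · filter_upwards [Ioi_mem_nhds hx] with y hy using amp_eq hθ hy
  · rw [ampDeriv]; norm_num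

lemma hasDerivAt_ampDeriv {α θ x : ℝ} (hθ : 0 < θ) (hx : 0 < x) :
    HasDerivAt (ampDeriv α θ) (ampDeriv₂ α θ x) x := by
  have hg := one_le_one_add_mul_rpow (α := α) hθ hx.le
  have h := ((((Real.hasDerivAt_rpow_const (x := x) (p := α - 1) (Or.inl hx.ne')).const_mul
    α).const_mul θ).mul_const (-(1 / 4))).mul
    ((hasDerivAt_one_add_mul_rpow (α := α) (θ := θ) hx).rpow_const
    (p := -(5 / 4)) (Or.inl (by linarith)))
  refine h.congr_deriv ?_
  rw [ampDeriv₂, show α - 1 - 1 = α - 2 by ring, show (-(5 / 4) - 1 : ℝ) = -(9 / 4) by norm_num]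
  ring

lemma Mfun_eq {α θ x : ℝ} (hθ : 0 < θ) (hx : 0 < x) :
    Mfun α θ x = amp α θ x * ampDeriv₂ α θ x := by
  have h : deriv (amp α θ) =ᶠ[𝓝 x] ampDeriv α θ := by
    filter_upwards [Ioi_mem_nhds hx] with y hy using (hasDerivAt_amp hθ hy).deriv
  have h2 : deriv (deriv (amp α θ)) x = ampDeriv₂ α θ x := by
    rw [h.deriv_eq, (hasDerivAt_ampDeriv hθ hx).deriv]
  rw [Mfun, if_pos hx, ← h2]
  rfl

lemma continuousOn_ampDeriv₂ {α θ : ℝ} (hθ : 0 < θ) : ContinuousOn (ampDeriv₂ α θ) (Ioi 0) := by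
  have hr : ∀ p : ℝ, ContinuousOn (fun x : ℝ => x ^ p) (Ioi 0) := fun p =>
    continuousOn_id.rpow_const fun x hx => Or.inl (ne_of_gt hx)
  have hg : ∀ p : ℝ, ContinuousOn (fun x : ℝ => (1 + θ * x ^ α) ^ p) (Ioi 0) := fun p =>
    (continuousOn_const.add (continuousOn_const.mul (hr α))).rpow_const fun x hx =>
      Or.inl (zero_lt_one.trans_le (one_le_one_add_mul_rpow hθ (le_of_lt hx))).ne'
  have h1 := hr (α - 1)
  have h2 := hr (α - 2)
  have h3 := hg (-(5 / 4))
  have h4 := hg (-(9 / 4))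
  unfold ampDeriv₂
  fun_prop

lemma abs_amp_mul_ampDeriv₂_le {α θ x : ℝ} (hθ : 0 < θ) (hx : 0 < x) :
    |amp α θ x * ampDeriv₂ α θ x| ≤ (|α * (α - 1)| + α ^ 2) * x ^ (-2 : ℝ) := by
  have hg := one_le_one_add_mul_rpow (α := α) hθ hx.le
  set t := θ * x ^ α with ht
  have ht0 : 0 ≤ t := mul_nonneg hθ.le (Real.rpow_nonneg hx.le _)
  have hb1 : amp α θ x ≤ 1 :=
    Real.rpow_le_one (spd_pos hθ x).le (spd_le_one hθ x) (by norm_num)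
  have hx2 : 0 ≤ x ^ (-2 : ℝ) := Real.rpow_nonneg hx.le _
  have e1 : θ * x ^ (α - 2) = t * x ^ (-2 : ℝ) := by
    rw [ht, mul_assoc, ← Real.rpow_add hx]; ring_nf
  have e2 : (θ * x ^ (α - 1)) ^ 2 = t ^ 2 * x ^ (-2 : ℝ) := by
    rw [ht, mul_pow, mul_pow, mul_assoc, ← Real.rpow_natCast (x ^ _), ← Real.rpow_natCast (x ^ _),
      ← Real.rpow_mul hx.le, ← Real.rpow_mul hx.le, ← Real.rpow_add hx]
    push_cast
    ring_nf
  have g1 : t * (1 + t) ^ (-(5 / 4) : ℝ) ≤ 1 := by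
    calc t * (1 + t) ^ (-(5 / 4) : ℝ) ≤ (1 + t) * (1 + t) ^ (-1 : ℝ) := by
          gcongr
          · linarith
          · norm_num
      _ = 1 := by rw [Real.rpow_neg_one, mul_inv_cancel₀ (by linarith)]
  have g2 : t ^ 2 * (1 + t) ^ (-(9 / 4) : ℝ) ≤ 1 := by
    calc t ^ 2 * (1 + t) ^ (-(9 / 4) : ℝ) ≤ (1 + t) ^ 2 * (1 + t) ^ (-2 : ℝ) := by
          gcongr
          · linarith
          · norm_num
      _ = 1 := by
        rw [Real.rpow_neg (by linarith), Real.rpow_two, mul_inv_cancel₀ (by positivity)]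
  have g1' : 0 ≤ t * (1 + t) ^ (-(5 / 4) : ℝ) := by positivity
  have g2' : 0 ≤ t ^ 2 * (1 + t) ^ (-(9 / 4) : ℝ) := by positivity
  have e3 : ampDeriv₂ α θ x =
      (-(1 / 4) * (α * (α - 1)) * (t * (1 + t) ^ (-(5 / 4) : ℝ)) +
        5 / 16 * α ^ 2 * (t ^ 2 * (1 + t) ^ (-(9 / 4) : ℝ))) * x ^ (-2 : ℝ) := by
    rw [ampDeriv₂]
    linear_combination (α * (α - 1) * (-(1 / 4)) * (1 + t) ^ (-(5 / 4) : ℝ)) * e1 +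
      (α ^ 2 * (5 / 16) * (1 + t) ^ (-(9 / 4) : ℝ)) * e2
  rw [abs_mul, abs_of_pos (amp_pos hθ x), e3, abs_mul, abs_of_nonneg hx2, ← mul_assoc]
  refine mul_le_mul_of_nonneg_right ?_ hx2
  refine (mul_le_of_le_one_left (abs_nonneg _) hb1).trans ((abs_add_le _ _).trans ?_)
  refine add_le_add ?_ ?_
  · rw [abs_mul, abs_of_nonneg g1', abs_mul]
    norm_num
    nlinarith [abs_nonneg (α * (α - 1)),
      mul_le_mul_of_nonneg_left g1 (abs_nonneg (α * (α - 1))), abs_mul α (α - 1)]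
  · rw [abs_mul, abs_of_nonneg g2', abs_of_nonneg (by positivity)]
    nlinarith [sq_nonneg α, mul_le_mul_of_nonneg_left g2 (sq_nonneg α)]

lemma integrableOn_amp_mul_ampDeriv₂ {α θ x₀ : ℝ} (hθ : 0 < θ) (hx₀ : 0 < x₀) :
    IntegrableOn (fun x => amp α θ x * ampDeriv₂ α θ x) (Ioi x₀) := by
  have hsub : Ioi x₀ ⊆ Ioi 0 := Ioi_subset_Ioi hx₀.le
  have hc : ContinuousOn (fun x => amp α θ x * ampDeriv₂ α θ x) (Ioi x₀) :=
    ContinuousOn.mul (fun x hx => (hasDerivAt_amp hθ (hsub hx)).continuousAt.continuousWithinAt)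
      ((continuousOn_ampDeriv₂ hθ).mono hsub)
  refine ((integrableOn_Ioi_rpow_of_lt (by norm_num : (-2 : ℝ) < -1) hx₀).const_mul
    (|α * (α - 1)| + α ^ 2)).mono' (hc.aestronglyMeasurable measurableSet_Ioi) ?_
  filter_upwards [ae_restrict_mem measurableSet_Ioi] with x hx
  exact abs_amp_mul_ampDeriv₂_le hθ (hsub hx)

lemma hasDerivAt_phase {α θ : ℝ} (hα : 0 < α) (hθ : 0 < θ) (x : ℝ) :
    HasDerivAt (phase α θ) (spd α θ x)⁻¹ x :=
  (((spd_continuous hα hθ).inv₀ fun x =>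
    (spd_pos hθ x).ne').integral_hasStrictDerivAt 0 x).hasDerivAt

lemma phase_monotone {α θ : ℝ} (hα : 0 < α) (hθ : 0 < θ) : Monotone (phase α θ) :=
  monotone_of_hasDerivAt_nonneg (hasDerivAt_phase hα hθ) fun x => (inv_pos.2 (spd_pos hθ x)).le

lemma le_phase {α θ x : ℝ} (hα : 0 < α) (hθ : 0 < θ) (hx : 0 ≤ x) : x ≤ phase α θ x := by
  have hm : Monotone fun x => phase α θ x - x :=
    monotone_of_hasDerivAt_nonneg (fun x => (hasDerivAt_phase hα hθ x).sub (hasDerivAt_id x))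
      fun x => sub_nonneg.2 ((one_le_inv₀ (spd_pos hθ x)).2 (spd_le_one hθ x))
  have := hm hx
  simp only [phase, intervalIntegral.integral_same] at this ⊢
  linarith

lemma inv_amp_le {α θ ε x : ℝ} (hα : 0 < α) (hθ : 0 < θ) (hε : 0 < ε) (hx : 0 < x) :
    (amp α θ x)⁻¹ ≤ (1 + θ * (α / ε) ^ α) * Real.exp (ε * phase α θ x) := by
  have hg := one_le_one_add_mul_rpow (α := α) hθ hx.le
  have hxα : x ^ α ≤ (α / ε) ^ α * Real.exp (ε * x) := by
    have h1 : x = α / ε * (ε * x / α) := by field_simp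
    have h2 : ε * x / α ≤ Real.exp (ε * x / α) := by
      linarith [Real.add_one_le_exp (ε * x / α)]
    calc x ^ α = (α / ε) ^ α * (ε * x / α) ^ α := by
          rw [← Real.mul_rpow (by positivity) (by positivity), ← h1]
      _ ≤ (α / ε) ^ α * Real.exp (ε * x / α) ^ α := by gcongr
      _ = _ := by rw [← Real.exp_mul, div_mul_cancel₀ _ hα.ne']
  calc (amp α θ x)⁻¹ = (1 + θ * x ^ α) ^ (1 / 4 : ℝ) := by
        rw [amp_eq hθ hx, Real.rpow_neg (by linarith), inv_inv]
    _ ≤ (1 + θ * x ^ α) ^ (1 : ℝ) := Real.rpow_le_rpow_of_exponent_le hg (by norm_num)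
    _ = 1 + θ * x ^ α := Real.rpow_one _
    _ ≤ Real.exp (ε * x) + θ * ((α / ε) ^ α * Real.exp (ε * x)) := by
        gcongr
        exact Real.one_le_exp (by positivity)
    _ = (1 + θ * (α / ε) ^ α) * Real.exp (ε * x) := by ring
    _ ≤ _ := by
        gcongr
        exact le_phase hα hθ hx.le

lemma Sseq_mul_exp_eq {α θ x₀ σ : ℝ} (hα : 0 < α) (hθ : 0 < θ) (hx₀ : 0 < x₀) (hσ : σ ≤ 0)
    (n : ℕ) {x : ℝ} (hx : x ∈ Ici x₀) :
    Sseq α θ x₀ σ n x *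
        Complex.exp (2 * Complex.I * (1 + Complex.I * (σ : ℂ)) * (phase α θ x : ℂ)) =
      (volt (Complex.I * (1 + Complex.I * σ)) (phase α θ) (fun x => amp α θ x * ampDeriv₂ α θ x)
        x₀)^[n] 1 x := by
  set κ : ℂ := Complex.I * (1 + Complex.I * σ) with hκdef
  have hκ : 0 ≤ κ.re := by simp [hκdef, hσ]
  have hM := integrableOn_amp_mul_ampDeriv₂ (α := α) hθ hx₀
  have hφc : ContinuousOn (phase α θ) (Ici x₀) := fun x _ =>
    (hasDerivAt_phase hα hθ x).continuousAt.continuousWithinAt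
  have e1 : 2 * Complex.I * (1 + Complex.I * (σ : ℂ)) = 2 * κ := by rw [hκdef]; ring
  have e2 : -2 * Complex.I * (1 + Complex.I * (σ : ℂ)) = -(2 * κ) := by rw [hκdef]; ring
  induction n generalizing x with
  | zero =>
    simp only [Sseq, Function.iterate_zero, id, Pi.one_apply]
    rw [← Complex.exp_add, e1, e2]
    simp
  | succ n ih =>
    obtain ⟨hsc, hsb⟩ := volt_iterate_one hκ hM hφc n
    rw [e1] at ih ⊢
    rw [Function.iterate_succ_apply', volt, setIntegral_volt_integrand hx
      ((phase_monotone hα hθ).monotoneOn _) (integrableOn_volt_integrand (τ := 0) x hM hφc hsc le_rfl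
        (by linarith) (fun y hy => by simpa using hsb y hy))]
    have hS : ∀ y ∈ Ici x₀, Sseq α θ x₀ σ n y = (volt κ (phase α θ)
        (fun x => amp α θ x * ampDeriv₂ α θ x) x₀)^[n] 1 y *
          Complex.exp (-(2 * κ) * phase α θ y) := fun y hy => by
      rw [← ih hy, mul_assoc, ← Complex.exp_add]
      simp
    have hMy : ∀ y ∈ Ici x₀, Mfun α θ y = amp α θ y * ampDeriv₂ α θ y := fun y hy =>
      Mfun_eq hθ (hx₀.trans_le hy)
    have hexp : Complex.exp (-(2 * κ) * phase α θ x) * Complex.exp (2 * κ * phase α θ x) = 1 := by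
      rw [← Complex.exp_add]; simp
    simp only [Sseq, Kop]
    rw [e1, e2]
    have i1 : ∫ y in x₀..x, (Mfun α θ y : ℂ) * Sseq α θ x₀ σ n y *
          Complex.exp (-(2 * κ) * ((phase α θ x - phase α θ y : ℝ) : ℂ)) =
        Complex.exp (-(2 * κ) * phase α θ x) * ∫ y in x₀..x,
          ((amp α θ y * ampDeriv₂ α θ y : ℝ) : ℂ) * (volt κ (phase α θ)
          (fun x => amp α θ x * ampDeriv₂ α θ x) x₀)^[n] 1 y := by
      rw [← intervalIntegral.integral_const_mul]
      refine intervalIntegral.integral_congr fun y hy => ?_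
      rw [uIcc_of_le hx] at hy
      have he : Complex.exp (-(2 * κ) * phase α θ y) *
          Complex.exp (-(2 * κ) * ((phase α θ x - phase α θ y : ℝ) : ℂ)) =
          Complex.exp (-(2 * κ) * phase α θ x) := by
        rw [← Complex.exp_add]; push_cast; ring_nf
      simp only [hS y hy.1, hMy y hy.1, ← he]
      ring
    have i2 : ∫ y in Ioi x, (Mfun α θ y : ℂ) * Sseq α θ x₀ σ n y =
        ∫ y in Ioi x, ((amp α θ y * ampDeriv₂ α θ y : ℝ) : ℂ) * (volt κ (phase α θ)
          (fun x => amp α θ x * ampDeriv₂ α θ x) x₀)^[n] 1 y *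
          Complex.exp (-(2 * κ) * phase α θ y) := by
      refine setIntegral_congr_fun measurableSet_Ioi fun y hy => ?_
      have hy0 : y ∈ Ici x₀ := Ici_subset_Ici.2 hx (Ioi_subset_Ici_self hy)
      simp only [hS y hy0, hMy y hy0]
      ring
    rw [i1, i2]
    linear_combination ((2 * κ)⁻¹ * ∫ y in x₀..x,
          ((amp α θ y * ampDeriv₂ α θ y : ℝ) : ℂ) * (volt κ (phase α θ)
          (fun x => amp α θ x * ampDeriv₂ α θ x) x₀)^[n] 1 y) * hexp

/-- characterization of bounded solutions of the damped equation. -/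
theorem stmt4 (α θ x₀ σ : ℝ) (hα : 0 < α) (hθ : 0 < θ) (hx₀ : 0 < x₀)
    (hM : Mtail α θ x₀ < 2) (hσ : σ < 0)
    (u u' : ℝ → ℂ)
    (hu : ∀ x ∈ Ici x₀, HasDerivAt u (u' x) x)
    (hu' : ∀ x ∈ Ici x₀,
      HasDerivAt u' (-(1 + Complex.I * (σ : ℂ)) ^ 2 * ((spd α θ x : ℂ))⁻¹ ^ 2 * u x) x) :
    (∃ C, ∀ x ∈ Ici x₀, ‖u x‖ ≤ C) ↔
      ∃ A : ℂ, ∀ x ∈ Ici x₀,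
        u x = A *
          (∑' n : ℕ, Sseq α θ x₀ σ n x *
            Complex.exp (2 * Complex.I * (1 + Complex.I * (σ : ℂ)) * (phase α θ x : ℂ))) *
          (amp α θ x : ℂ) *
          Complex.exp (-Complex.I * (1 + Complex.I * (σ : ℂ)) * (phase α θ x : ℂ)) := by
  have hpos : ∀ x ∈ Ici x₀, 0 < x := fun x hx => hx₀.trans_le hx
  have hκ : 0 < (Complex.I * (1 + Complex.I * (σ : ℂ))).re := by simp [hσ]
  have hM' : ∫ y in Ioi x₀, |amp α θ y * ampDeriv₂ α θ y| < 2 := by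
    refine lt_of_eq_of_lt (setIntegral_congr_fun measurableSet_Ioi fun y hy => ?_) hM
    simp only [Mfun_eq hθ (hpos y (Ioi_subset_Ici_self hy))]
  have hnorm : 1 ≤ ‖Complex.I * (1 + Complex.I * (σ : ℂ))‖ := by
    rw [norm_mul, Complex.norm_I, one_mul]
    simpa using Complex.abs_re_le_norm (1 + Complex.I * (σ : ℂ))
  have hq : ‖(2 * (Complex.I * (1 + Complex.I * (σ : ℂ))))⁻¹‖ *
      (∫ y in Ioi x₀, |amp α θ y * ampDeriv₂ α θ y|) < 1 := by
    rw [norm_inv, norm_mul, Complex.norm_ofNat, inv_mul_lt_one₀ (by positivity)]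
    linarith
  have hφ : ∀ x, HasDerivAt (phase α θ) ((amp α θ x)⁻¹ ^ 2) x := fun x => by
    rw [inv_pow, amp_sq hθ]
    exact hasDerivAt_phase hα hθ x
  have hφtop : Tendsto (phase α θ) atTop atTop := by
    refine tendsto_atTop_mono' _ ?_ tendsto_id
    filter_upwards [Ici_mem_atTop 0] with x hx using le_phase hα hθ hx
  rw [bounded_iff_exists_eq_tsum hκ (fun x _ => amp_pos hθ x)
    (fun x hx => hasDerivAt_amp hθ (hpos x hx)) (fun x hx => hasDerivAt_ampDeriv hθ (hpos x hx))
    ((continuousOn_ampDeriv₂ hθ).mono hpos) ((amp_antitone hα hθ).antitoneOn _)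
    (fun x _ => hφ x) ((phase_monotone hα hθ).monotoneOn _)
    (fun x hx => (hpos x hx).le.trans (le_phase hα hθ (hpos x hx).le)) hφtop
    (integrableOn_amp_mul_ampDeriv₂ hθ hx₀) hq
    (fun ε hε => ⟨_, fun x hx => inv_amp_le hα hθ hε (hpos x hx)⟩) hu]
  · refine exists_congr fun A => forall₂_congr fun x hx => ?_
    simp only [Sseq_mul_exp_eq hα hθ hx₀ hσ.le _ hx, neg_mul]
  · intro x hx
    refine (hu' x hx).congr_deriv ?_
    rw [← amp_sq hθ x]
    push_cast
    linear_combination (-(1 + Complex.I * (σ : ℂ)) ^ 2 * (amp α θ x : ℂ)⁻¹ ^ 4 * u x) * Complex.I_sq
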